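/- Let P be a pree satisfying Axioms A(4) and A(5). Then every word over the alphabet P of length 4 or 5 whose image in the universal group U(P) is the identity element is reducible, i.e. the product of some two successive letters of the word is defined in P. -/

import Mathlib

/-- A pree: a set with identity, involutive inverse, and a partial multiplication
(represented as an `Option`-valued multiplication) satisfying the pree axioms. -/
structure Pree (α : Type*) where
  one : α
  inv : α → α
  mul : α → α → Option α
  one_mul' : ∀ a, mul one a = some a
  mul_one' : ∀ a, mul a one = some a
  inv_inv' : ∀ a, inv (inv a) = a
  mul_inv' : ∀ a, mul a (inv a) = some one
  inv_mul' : ∀ a, mul (inv a) a = some one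
  assoc_defined : ∀ {a b c x y : α}, mul a b = some x → mul b c = some y →
    ((mul x c).isSome ↔ (mul a y).isSome)
  assoc_eq : ∀ {a b c x y z : α}, mul a b = some x → mul b c = some y →
    mul x c = some z → mul a y = some z

namespace Pree

variable {α : Type*} (P : Pree α)

/-- The relators `a b c⁻¹` for every product `ab = c` defined in `P`. -/
def rels : Set (FreeGroup α) :=
  {r | ∃ a b c : α, P.mul a b = some c ∧
    r = FreeGroup.of a * FreeGroup.of b * (FreeGroup.of c)⁻¹}

/-- The universal group `U(P)` of a pree `P`. -/
abbrev UniversalGroup := PresentedGroup P.rels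

/-- The canonical map `π : P → U(P)`. -/
def pi (a : α) : P.UniversalGroup := PresentedGroup.of a

/-- Axiom A(4). -/
def A4 : Prop := ∀ a₁ a₂ a₃ a₄ b₁ b₂ b₃ b₄ : α,
  P.mul (P.inv a₁) a₂ = some b₁ → P.mul (P.inv a₂) a₃ = some b₂ →
  P.mul (P.inv a₃) a₄ = some b₃ → P.mul (P.inv a₄) a₁ = some b₄ →
  (P.mul b₁ b₂).isSome ∨ (P.mul b₂ b₃).isSome ∨ (P.mul b₃ b₄).isSome ∨ (P.mul b₄ b₁).isSome

/-- Axiom A(5). -/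
def A5 : Prop := ∀ a₁ a₂ a₃ a₄ a₅ b₁ b₂ b₃ b₄ b₅ : α,
  P.mul (P.inv a₁) a₂ = some b₁ → P.mul (P.inv a₂) a₃ = some b₂ →
  P.mul (P.inv a₃) a₄ = some b₃ → P.mul (P.inv a₄) a₅ = some b₄ →
  P.mul (P.inv a₅) a₁ = some b₅ →
  (P.mul b₁ b₂).isSome ∨ (P.mul b₂ b₃).isSome ∨ (P.mul b₃ b₄).isSome ∨
    (P.mul b₄ b₅).isSome ∨ (P.mul b₅ b₁).isSome

/-- A word over `P` is reducible if the product of two successive letters is defined. -/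
def Reducible (w : List α) : Prop :=
  ∃ (u : List α) (a b : α) (v : List α), w = u ++ a :: b :: v ∧ (P.mul a b).isSome

/-- The element of `U(P)` represented by a word over `P`. -/
def wordProd (w : List α) : P.UniversalGroup := (w.map P.pi).prod

end Pree

namespace Pree

section Arithmetic

variable {α : Type*} (P : Pree α) {a b c x y z : α}

theorem mul_assoc_left (hab : P.mul a b = some x) (hbc : P.mul b c = some y)
    (h : P.mul a y = some z) : P.mul x c = some z := by
  have hs : (P.mul x c).isSome := (P.assoc_defined hab hbc).2 (by simp [h])
  obtain ⟨w, hw⟩ := Option.isSome_iff_exists.1 hs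
  have := P.assoc_eq hab hbc hw
  rw [hw, ← this, h]

theorem inv_mul_eq (h : P.mul a b = some c) : P.mul (P.inv a) c = some b :=
  P.assoc_eq (P.inv_mul' a) h (P.one_mul' b)

theorem mul_inv_eq (h : P.mul a b = some c) : P.mul c (P.inv b) = some a :=
  P.mul_assoc_left h (P.mul_inv' b) (P.mul_one' a)

theorem inv_mul_inv_eq (h : P.mul a b = some c) :
    P.mul (P.inv b) (P.inv a) = some (P.inv c) :=
  P.inv_mul_eq (P.mul_inv_eq (P.inv_mul_eq h))

theorem eq_of_one_mul (h : P.mul P.one a = some b) : a = b := by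
  simpa [P.one_mul'] using h

theorem eq_of_mul_one (h : P.mul a P.one = some b) : a = b := by
  simpa [P.mul_one'] using h

theorem inv_one : P.inv P.one = P.one :=
  P.eq_of_one_mul (P.mul_inv' P.one)

/-- Adjacency in the link of a vertex of the Cayley complex. -/
def LinkAdj (a b : α) : Prop := (P.mul (P.inv a) b).isSome

variable {P}

theorem linkAdj_of_mul (h : P.mul a b = some c) : P.LinkAdj (P.inv a) b := by
  simp [LinkAdj, P.inv_inv', h]

theorem linkAdj_of_mul' (h : P.mul a b = some c) : P.LinkAdj b (P.inv a) := by
  simp [LinkAdj, P.inv_mul_inv_eq h]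

theorem linkAdj_right (h : P.mul a b = some c) : P.LinkAdj a c := by
  simp [LinkAdj, P.inv_mul_eq h]

theorem linkAdj_left (h : P.mul a b = some c) : P.LinkAdj c a := by
  have := linkAdj_of_mul' (P.inv_mul_eq h)
  rwa [P.inv_inv'] at this

theorem linkAdj_inv_inv (h : P.mul a b = some c) : P.LinkAdj (P.inv b) (P.inv c) :=
  linkAdj_of_mul (c := P.inv a) (by
    simpa [P.inv_inv'] using P.inv_mul_inv_eq (P.mul_inv_eq h))

theorem LinkAdj.exists_mul (h : P.LinkAdj (P.inv a) b) : ∃ c, P.mul a b = some c := by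
  simpa [LinkAdj, P.inv_inv', Option.isSome_iff_exists] using h

theorem LinkAdj.symm (h : P.LinkAdj a b) : P.LinkAdj b a := by
  obtain ⟨c, hc⟩ := Option.isSome_iff_exists.1 h
  have := linkAdj_of_mul' hc
  rwa [P.inv_inv'] at this

theorem linkAdj_of_isSome {a₁ a₂ a₃ b₁ b₂ : α}
    (h₁ : P.mul (P.inv a₁) a₂ = some b₁) (h₂ : P.mul (P.inv a₂) a₃ = some b₂)
    (h : (P.mul b₁ b₂).isSome) : P.LinkAdj a₁ a₃ := by
  have h₂' := P.inv_mul_eq h₂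
  rw [P.inv_inv'] at h₂'
  exact (P.assoc_defined h₁ h₂').1 h

/-- A(4) says that links have no induced 4-cycle. -/
theorem A4.chord (h4 : P.A4) {a₁ a₂ a₃ a₄ : α} (h₁ : P.LinkAdj a₁ a₂) (h₂ : P.LinkAdj a₂ a₃)
    (h₃ : P.LinkAdj a₃ a₄) (h₄ : P.LinkAdj a₄ a₁) : P.LinkAdj a₁ a₃ ∨ P.LinkAdj a₂ a₄ := by
  obtain ⟨b₁, h₁⟩ := Option.isSome_iff_exists.1 h₁
  obtain ⟨b₂, h₂⟩ := Option.isSome_iff_exists.1 h₂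
  obtain ⟨b₃, h₃⟩ := Option.isSome_iff_exists.1 h₃
  obtain ⟨b₄, h₄⟩ := Option.isSome_iff_exists.1 h₄
  rcases h4 _ _ _ _ _ _ _ _ h₁ h₂ h₃ h₄ with h | h | h | h
  · exact .inl (linkAdj_of_isSome h₁ h₂ h)
  · exact .inr (linkAdj_of_isSome h₂ h₃ h)
  · exact .inl (linkAdj_of_isSome h₃ h₄ h).symm
  · exact .inr (linkAdj_of_isSome h₄ h₁ h).symm

/-- A(5) says that links have no induced 5-cycle. -/
theorem A5.chord (h5 : P.A5) {a₁ a₂ a₃ a₄ a₅ : α} (h₁ : P.LinkAdj a₁ a₂)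
    (h₂ : P.LinkAdj a₂ a₃) (h₃ : P.LinkAdj a₃ a₄) (h₄ : P.LinkAdj a₄ a₅)
    (h₅ : P.LinkAdj a₅ a₁) :
    P.LinkAdj a₁ a₃ ∨ P.LinkAdj a₂ a₄ ∨ P.LinkAdj a₃ a₅ ∨ P.LinkAdj a₁ a₄ ∨
      P.LinkAdj a₂ a₅ := by
  obtain ⟨b₁, h₁⟩ := Option.isSome_iff_exists.1 h₁
  obtain ⟨b₂, h₂⟩ := Option.isSome_iff_exists.1 h₂
  obtain ⟨b₃, h₃⟩ := Option.isSome_iff_exists.1 h₃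
  obtain ⟨b₄, h₄⟩ := Option.isSome_iff_exists.1 h₄
  obtain ⟨b₅, h₅⟩ := Option.isSome_iff_exists.1 h₅
  rcases h5 _ _ _ _ _ _ _ _ _ _ h₁ h₂ h₃ h₄ h₅ with h | h | h | h | h
  · exact .inl (linkAdj_of_isSome h₁ h₂ h)
  · exact .inr (.inl (linkAdj_of_isSome h₂ h₃ h))
  · exact .inr (.inr (.inl (linkAdj_of_isSome h₃ h₄ h)))
  · exact .inr (.inr (.inr (.inl (linkAdj_of_isSome h₄ h₅ h).symm)))
  · exact .inr (.inr (.inr (.inr (linkAdj_of_isSome h₅ h₁ h).symm)))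

end Arithmetic

universe u

/-- Two consecutive spheres `U` and `V` (the outer one) of the Cayley complex of `U(P)`.
`down t x h` says that the edge labelled `x` leads from `t : U` outwards to `h : V`, and
`flatU t s t'` that the edge labelled `s` leads from `t` to `t'` inside `U`. -/
structure Stage {α : Type u} (P : Pree α) where
  U : Type u
  V : Type u
  flatU : U → α → U → Prop
  down : U → α → V → Prop
  flat_of_down : ∀ {t t' h y y'}, down t y h → down t' y' h →
    ∃ s, P.mul s y' = some y ∧ flatU t s t'
  down_of_flat : ∀ {t t' h s x x'}, flatU t s t' → P.mul s x' = some x →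
    down t' x' h → down t x h
  down_unique : ∀ {t y h h'}, down t y h → down t y h' → h = h'

namespace Stage

variable {α : Type u} {P : Pree α} (S : Stage P)

/-- The edges labelled `p` inside the outer sphere. -/
def Flat (h : S.V) (p : α) (h' : S.V) : Prop :=
  (p = P.one ∧ h = h') ∨ ∃ t y y', S.down t y h ∧ S.down t y' h' ∧ P.mul y p = some y'

/-- The edge labelled `x` at `h` leads outwards. -/
def Free (h : S.V) (x : α) : Prop :=
  x ≠ P.one ∧ ∀ t y, S.down t y h → P.mul y x = none

variable {S}

theorem Free.false_of_mul {h : S.V} {x y z : α} {t : S.U} (hf : S.Free h x)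
    (hd : S.down t y h) (hm : P.mul y x = some z) : False := by
  simp [hf.2 t y hd] at hm

theorem Flat.symm {h h' : S.V} {p : α} (H : S.Flat h p h') : S.Flat h' (P.inv p) h := by
  rcases H with ⟨rfl, rfl⟩ | ⟨t, y, y', hd, hd', hm⟩
  · exact .inl ⟨P.inv_one, rfl⟩
  · exact .inr ⟨t, y', y, hd', hd, P.mul_inv_eq hm⟩

theorem flat_refl (h : S.V) : S.Flat h P.one h := .inl ⟨rfl, rfl⟩

theorem Flat.eq_of_one {h h' : S.V} (H : S.Flat h P.one h') : h = h' := by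
  rcases H with ⟨-, rfl⟩ | ⟨t, y, y', hd, hd', hm⟩
  · rfl
  · obtain rfl := P.eq_of_mul_one hm
    exact S.down_unique hd hd'

/-- Along a flat edge labelled `q` from `h'`, any lower neighbour of `h'` whose label can be
multiplied by `q` is a lower neighbour of the endpoint. -/
theorem down_of_flat_of_mul {h h' : S.V} {t : S.U} {q z w : α} (H : S.Flat h q h')
    (hd : S.down t z h) (hm : P.mul z q = some w) : S.down t w h' := by
  rcases H with ⟨rfl, rfl⟩ | ⟨t', y, y', hd₁, hd₂, hm'⟩
  · obtain rfl := P.eq_of_mul_one hm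
    exact hd
  · obtain ⟨s, hs, hst⟩ := S.flat_of_down hd hd₁
    exact S.down_of_flat hst (P.assoc_eq hs hm' hm) hd₂

theorem Flat.trans (h4 : P.A4) {h h' h'' : S.V} {p q r : α} (H : S.Flat h p h')
    (H' : S.Flat h' q h'') (hm : P.mul p q = some r) : S.Flat h r h'' := by
  have K := H
  have K' := H'
  rcases H with ⟨rfl, rfl⟩ | ⟨t, y, z, hd, hd', hyz⟩
  · obtain rfl := P.eq_of_one_mul hm
    exact H'
  rcases H' with ⟨rfl, rfl⟩ | ⟨t', y', z', hd₁, hd₁', hyz'⟩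
  · obtain rfl := P.eq_of_mul_one hm
    exact K
  obtain ⟨s, hs, -⟩ := S.flat_of_down hd' hd₁
  rcases h4.chord (linkAdj_of_mul (P.mul_inv_eq hs)) (linkAdj_of_mul hyz')
    (linkAdj_of_mul' hm) (linkAdj_inv_inv hyz) with h | h
  · obtain ⟨w, hw⟩ := h.exists_mul
    exact .inr ⟨t, y, w, hd, down_of_flat_of_mul K' hd' hw, P.assoc_eq hyz hm hw⟩
  · obtain ⟨w, hw⟩ := h.exists_mul
    refine .inr ⟨t', w, z', down_of_flat_of_mul K.symm hd₁ hw, hd₁', ?_⟩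
    have hw' := P.mul_inv_eq hw
    rw [P.inv_inv'] at hw'
    exact P.assoc_eq hw' hm hyz'

theorem Free.of_flat (h4 : P.A4) {t t' : S.V} {p x x' : α} (H : S.Flat t p t')
    (hm : P.mul p x' = some x) (hf : S.Free t' x') : S.Free t x := by
  have K := H
  rcases H with ⟨rfl, rfl⟩ | ⟨k, w, w', hd, hd', hw⟩
  · obtain rfl := P.eq_of_one_mul hm
    exact hf
  refine ⟨?_, fun j z hj => Option.eq_none_iff_forall_ne_some.2 fun v hv => ?_⟩
  · rintro rfl
    obtain rfl : P.inv p = x' := P.eq_of_mul_one (P.inv_mul_eq hm)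
    exact hf.false_of_mul hd' (P.mul_inv_eq hw)
  · obtain ⟨s, hs, -⟩ := S.flat_of_down hj hd
    rcases h4.chord (linkAdj_of_mul (P.mul_inv_eq hs)) (linkAdj_of_mul hw)
      (linkAdj_right hm) (linkAdj_of_mul' hv) with h | h
    · obtain ⟨m, hmul⟩ := h.exists_mul
      exact hf.false_of_mul (down_of_flat_of_mul K hj hmul) (P.mul_assoc_left hmul hm hv)
    · obtain ⟨m, hmul⟩ := h.exists_mul
      exact hf.false_of_mul hd' (P.mul_assoc_left hw hm hmul)

/-- Three vertices of a sphere, consecutively adjacent and with a common outer neighbour, are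
pairwise adjacent. -/
theorem Free.exists_mul_of_flat (h4 : P.A4) (h5 : P.A5) {h h' h'' : S.V} {p q x x' x'' : α}
    (H : S.Flat h p h') (H' : S.Flat h' q h'') (hf : S.Free h' x')
    (hx : P.mul p x' = some x) (hx' : P.mul q x'' = some x') : ∃ r, P.mul p q = some r := by
  rcases H with ⟨rfl, rfl⟩ | ⟨t, y, z, -, hd, hyz⟩
  · exact ⟨q, P.one_mul' q⟩
  rcases H' with ⟨rfl, rfl⟩ | ⟨t', y', z', hd', -, hyz'⟩
  · exact ⟨p, P.mul_one' p⟩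
  obtain ⟨s, hs, -⟩ := S.flat_of_down hd hd'
  have e₁ : P.LinkAdj (P.inv p) (P.inv z) := linkAdj_inv_inv hyz
  have e₂ : P.LinkAdj (P.inv z) (P.inv y') := linkAdj_of_mul (P.mul_inv_eq hs)
  have e₃ : P.LinkAdj (P.inv y') q := linkAdj_of_mul hyz'
  have e₄ : P.LinkAdj q x' := linkAdj_right hx'
  have e₅ : P.LinkAdj x' (P.inv p) := linkAdj_of_mul' hx
  have no : ∀ {t y}, S.down t y h' → ¬ P.LinkAdj (P.inv y) x' := fun hd e =>
    let ⟨_, hm⟩ := e.exists_mul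
    hf.false_of_mul hd hm
  rcases h5.chord e₁ e₂ e₃ e₄ e₅ with h | h | h | h | h
  · exact ((h4.chord h e₃ e₄ e₅).resolve_right (no hd')).exists_mul
  · exact ((h4.chord e₁ h e₄ e₅).resolve_right (no hd)).exists_mul
  · exact (no hd' h).elim
  · exact h.exists_mul
  · exact (no hd h).elim

variable (S)

/-- Outward edges are identified when they have the same endpoint. -/
def outSetoid (h4 : P.A4) (h5 : P.A5) : Setoid {e : S.V × α // S.Free e.1 e.2} where
  r e e' := ∃ p, S.Flat e.1.1 p e'.1.1 ∧ P.mul p e'.1.2 = some e.1.2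
  iseqv :=
    { refl := fun e => ⟨P.one, flat_refl _, P.one_mul' _⟩
      symm := fun ⟨p, hp, hm⟩ => ⟨P.inv p, hp.symm, P.inv_mul_eq hm⟩
      trans := by
        rintro e e' e'' ⟨p, hp, hm⟩ ⟨q, hq, hm'⟩
        obtain ⟨r, hr⟩ := Free.exists_mul_of_flat h4 h5 hp hq e'.2 hm hm'
        exact ⟨r, hp.trans h4 hq hr, P.mul_assoc_left hr hm' hm⟩ }

/-- The next pair of spheres. -/
def next (h4 : P.A4) (h5 : P.A5) : Stage P where
  U := S.V
  V := Quotient (S.outSetoid h4 h5)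
  flatU := S.Flat
  down t x h := ∃ hf : S.Free t x, Quotient.mk (S.outSetoid h4 h5) ⟨(t, x), hf⟩ = h
  flat_of_down := by
    rintro t t' h y y' ⟨hf, rfl⟩ ⟨hf', he⟩
    obtain ⟨p, hp, hm⟩ := Quotient.exact he.symm
    exact ⟨p, hm, hp⟩
  down_of_flat := by
    rintro t t' h s x x' hs hm ⟨hf, rfl⟩
    exact ⟨hf.of_flat h4 hs hm, Quotient.sound ⟨s, hs, hm⟩⟩
  down_unique := by
    rintro t y h h' ⟨hf, rfl⟩ ⟨hf', rfl⟩
    rfl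

/-- Every label can be followed from every vertex of the outer sphere. -/
def Total : Prop :=
  ∀ g a, S.Free g a ∨ (∃ h, S.Flat g a h) ∨ ∃ t, S.down t (P.inv a) g

variable {S}

theorem Total.next {h4 : P.A4} {h5 : P.A5} (hS : S.Total) : (S.next h4 h5).Total := by
  intro g a
  by_cases hf : (S.next h4 h5).Free g a
  · exact .inl hf
  by_cases ha : a = P.one
  · exact .inr (.inl ⟨g, ha ▸ flat_refl g⟩)
  have : ∃ k y z, (S.next h4 h5).down k y g ∧ P.mul y a = some z := by
    simp only [Free, not_and, not_forall] at hf
    obtain ⟨k, y, hd, hn⟩ := hf ha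
    obtain ⟨z, hz⟩ := Option.ne_none_iff_exists'.1 hn
    exact ⟨k, y, z, hd, hz⟩
  obtain ⟨k, y, z, hd, hz⟩ := this
  have hza : P.mul (P.inv z) y = some (P.inv a) := by
    have := P.inv_mul_inv_eq (P.inv_mul_eq hz)
    rwa [P.inv_inv'] at this
  rcases hS k z with hk | ⟨m, hm⟩ | ⟨j, hj⟩
  · exact .inr (.inl ⟨Quotient.mk _ ⟨(k, z), hk⟩, .inr ⟨k, y, z, hd, ⟨hk, rfl⟩, hz⟩⟩)
  · exact .inr (.inr ⟨m, (S.next h4 h5).down_of_flat hm.symm hza hd⟩)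
  · exact (hd.1.false_of_mul hj hza).elim

variable (P)

/-- The base vertex, with nothing inside it. -/
def base : Stage P where
  U := PEmpty
  V := PUnit
  flatU _ _ _ := False
  down _ _ _ := False
  flat_of_down h := h.elim
  down_of_flat h := h.elim
  down_unique h := h.elim

variable {P}

theorem base_total : (base P).Total := by
  intro g a
  by_cases ha : a = P.one
  · exact .inr (.inl ⟨g, ha ▸ flat_refl g⟩)
  · exact .inl ⟨ha, fun t => t.elim⟩

theorem base_flat {g g' : (base P).V} {p : α} (H : (base P).Flat g p g') : p = P.one := by
  rcases H with ⟨h, -⟩ | ⟨t, -⟩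
  · exact h
  · exact t.elim

theorem base_free {g : (base P).V} {a : α} (ha : a ≠ P.one) : (base P).Free g a :=
  ⟨ha, fun t => t.elim⟩

theorem base_next_down_inj {h4 : P.A4} {h5 : P.A5} {t t' : PUnit}
    {v : ((base P).next h4 h5).V} {y y' : α}
    (hd : ((base P).next h4 h5).down t y v) (hd' : ((base P).next h4 h5).down t' y' v) :
    y' = y := by
  obtain ⟨s, hs, hst⟩ := ((base P).next h4 h5).flat_of_down hd hd'
  obtain rfl := base_flat hst
  exact P.eq_of_one_mul hs

end Stage

section Action

variable {α : Type u} {P : Pree α} (h4 : P.A4) (h5 : P.A5)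

/-- The `n`-th sphere together with the one inside it. -/
def stage : ℕ → Stage P
  | 0 => Stage.base P
  | n + 1 => (stage n).next h4 h5

theorem stage_total : ∀ n, (stage h4 h5 n).Total
  | 0 => Stage.base_total
  | n + 1 => (stage_total n).next

/-- The vertices of the Cayley complex, sorted by their distance from the base vertex. -/
abbrev Vertex := Σ n, (stage h4 h5 n).V

/-- The labelled edges of the Cayley complex. -/
inductive Step : Vertex h4 h5 → α → Vertex h4 h5 → Prop
  | up {n : ℕ} {g : (stage h4 h5 n).V} {a : α} {h : (stage h4 h5 (n + 1)).V} :
      (stage h4 h5 (n + 1)).down g a h → Step ⟨n, g⟩ a ⟨n + 1, h⟩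
  | flat {n : ℕ} {g : (stage h4 h5 n).V} {a : α} {h : (stage h4 h5 n).V} :
      (stage h4 h5 n).Flat g a h → Step ⟨n, g⟩ a ⟨n, h⟩
  | down {n : ℕ} {g : (stage h4 h5 (n + 1)).V} {a : α} {h : (stage h4 h5 n).V} :
      (stage h4 h5 (n + 1)).down h (P.inv a) g → Step ⟨n + 1, g⟩ a ⟨n, h⟩

variable {h4 h5}

theorem exists_step (g : Vertex h4 h5) (a : α) : ∃ h, Step h4 h5 g a h := by
  obtain ⟨n, g⟩ := g
  rcases stage_total h4 h5 n g a with hf | ⟨h, hh⟩ | ⟨t, ht⟩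
  · exact ⟨⟨n + 1, Quotient.mk _ ⟨(g, a), hf⟩⟩, .up ⟨hf, rfl⟩⟩
  · exact ⟨⟨n, h⟩, .flat hh⟩
  · cases n with
    | zero => exact t.elim
    | succ n => exact ⟨⟨n, t⟩, .down ht⟩

theorem Step.symm {g h : Vertex h4 h5} {a : α} (H : Step h4 h5 g a h) :
    Step h4 h5 h (P.inv a) g := by
  cases H with
  | up H => exact .down (by rwa [P.inv_inv'])
  | flat H => exact .flat H.symm
  | down H => exact .up H

theorem Step.trans {g h k : Vertex h4 h5} {a b c : α} (H : Step h4 h5 g a h)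
    (H' : Step h4 h5 h b k) (hc : P.mul a b = some c) : Step h4 h5 g c k := by
  cases H with
  | @up n g _ h H =>
    cases H' with
    | up H' => exact (H'.1.false_of_mul H hc).elim
    | flat H' => exact .up (Stage.down_of_flat_of_mul H' H hc)
    | down H' =>
      obtain ⟨s, hs, hst⟩ := (stage h4 h5 (n + 1)).flat_of_down H H'
      have := P.mul_inv_eq hs
      rw [P.inv_inv', hc] at this
      obtain rfl := Option.some.inj this
      exact .flat hst
  | @flat n g _ h H =>
    cases H' with
    | up H' => exact .up ((stage h4 h5 (n + 1)).down_of_flat H hc H')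
    | flat H' => exact .flat (H.trans h4 H' hc)
    | down H' =>
      exact .down (Stage.down_of_flat_of_mul H.symm H' (P.inv_mul_inv_eq hc))
  | @down n g _ h H =>
    cases H' with
    | up H' => exact .flat (.inr ⟨_, _, _, H, H', P.inv_mul_eq hc⟩)
    | flat H' => exact .down ((stage h4 h5 (n + 1)).down_of_flat H'.symm (P.inv_mul_inv_eq hc) H)
    | down H' =>
      have := P.inv_mul_inv_eq hc
      exact (H.1.false_of_mul H' this).elim

theorem Step.eq_of_one {g h : Vertex h4 h5} (H : Step h4 h5 g P.one h) : g = h := by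
  cases H with
  | up H => exact (H.1.1 rfl).elim
  | flat H => rw [H.eq_of_one]
  | down H => exact (H.1.1 P.inv_one).elim

theorem Step.unique {g h h' : Vertex h4 h5} {a : α} (H : Step h4 h5 g a h)
    (H' : Step h4 h5 g a h') : h = h' :=
  (H.symm.trans H' (P.inv_mul' a)).eq_of_one

variable (h4 h5)

/-- The permutation of the vertices following the edges labelled `a`. -/
noncomputable def stepPerm (a : α) : Equiv.Perm (Vertex h4 h5) where
  toFun g := (exists_step g a).choose
  invFun g := (exists_step g (P.inv a)).choose
  left_inv g := (exists_step _ _).choose_spec.unique (exists_step g a).choose_spec.symm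
  right_inv g := by
    have h := (exists_step g (P.inv a)).choose_spec.symm
    rw [P.inv_inv'] at h
    exact (exists_step _ _).choose_spec.unique h

theorem step_stepPerm (g : Vertex h4 h5) (a : α) : Step h4 h5 g a (stepPerm h4 h5 a g) :=
  (exists_step g a).choose_spec

theorem stepPerm_mul {a b c : α} (h : P.mul a b = some c) :
    stepPerm h4 h5 b * stepPerm h4 h5 a = stepPerm h4 h5 c := by
  ext1 g
  exact ((step_stepPerm h4 h5 g a).trans (step_stepPerm h4 h5 _ b) h).unique
    (step_stepPerm h4 h5 g c)

/-- The action of the universal group on the vertices. -/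
noncomputable def stepHom : P.UniversalGroup →* Equiv.Perm (Vertex h4 h5) :=
  PresentedGroup.toGroup (f := fun a => (stepPerm h4 h5 a)⁻¹) (by
    rintro _ ⟨a, b, c, h, rfl⟩
    simp [← stepPerm_mul h4 h5 h])

theorem stepHom_pi (a : α) : stepHom h4 h5 (P.pi a) = (stepPerm h4 h5 a)⁻¹ :=
  PresentedGroup.toGroup.of _

/-- The base vertex. -/
def origin : Vertex h4 h5 := ⟨0, PUnit.unit⟩

variable {h4 h5}

/-- A two-letter word that cannot be multiplied leads from the origin to the second sphere. -/
theorem exists_down_down {a b : α} (hab : P.mul a b = none) :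
    ∃ (v : (stage h4 h5 1).V) (g : (stage h4 h5 2).V),
      (stage h4 h5 1).down PUnit.unit a v ∧ (stage h4 h5 2).down v b g := by
  have ha : a ≠ P.one := by
    rintro rfl
    simp [P.one_mul'] at hab
  have hb : b ≠ P.one := by
    rintro rfl
    simp [P.mul_one'] at hab
  have hd : (stage h4 h5 1).down PUnit.unit a
      (Quotient.mk _ ⟨(PUnit.unit, a), Stage.base_free ha⟩) :=
    ⟨Stage.base_free ha, rfl⟩
  have hf : (stage h4 h5 1).Free (Quotient.mk _ ⟨(PUnit.unit, a), Stage.base_free ha⟩) b := by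
    refine ⟨hb, fun t y hy => ?_⟩
    rw [Stage.base_next_down_inj hd hy, hab]
  exact ⟨_, Quotient.mk _ ⟨(_, b), hf⟩, hd, hf, rfl⟩

theorem stepPerm_eq {g h : Vertex h4 h5} {a : α} (H : Step h4 h5 g a h) :
    stepPerm h4 h5 a g = h :=
  (step_stepPerm h4 h5 g a).unique H

end Action

section ShortWords

variable {α : Type u} {P : Pree α} {a b c d e : α}

theorem inv_mul_inv_eq_none (h : P.mul a b = none) : P.mul (P.inv b) (P.inv a) = none := by
  refine Option.eq_none_iff_forall_ne_some.2 fun x hx => ?_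
  have := P.inv_mul_inv_eq hx
  simp [P.inv_inv', h] at this

theorem mul_ne_none_of_wordProd_four (h4 : P.A4) (h5 : P.A5)
    (hw : P.wordProd [a, b, c, d] = 1) (hab : P.mul a b = none) (hcd : P.mul c d = none) :
    P.mul b c ≠ none := by
  obtain ⟨v, g, hv, hg⟩ := exists_down_down (h4 := h4) (h5 := h5) hab
  obtain ⟨v', g', hv', hg'⟩ := exists_down_down (h4 := h4) (h5 := h5) (inv_mul_inv_eq_none hcd)
  have hw := congrArg (stepHom h4 h5) hw
  simp only [wordProd, List.map, List.prod_cons, List.prod_nil, map_mul, map_one,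
    stepHom_pi, mul_one] at hw
  have hw := congrArg (fun f => f⁻¹ (origin h4 h5)) hw
  simp only [mul_inv_rev, inv_inv, _root_.inv_one, Equiv.Perm.coe_mul, Function.comp,
    Equiv.Perm.coe_one, id] at hw
  have s₁ : Step h4 h5 (origin h4 h5) a ⟨1, v⟩ := .up hv
  have s₂ : Step h4 h5 ⟨1, v⟩ b ⟨2, g⟩ := .up hg
  have s₃ : Step h4 h5 ⟨2, g'⟩ c ⟨1, v'⟩ := .down hg'
  have s₄ : Step h4 h5 ⟨1, v'⟩ d (origin h4 h5) := .down hv'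
  rw [stepPerm_eq s₁, stepPerm_eq s₂, ← stepPerm_eq s₄, ← stepPerm_eq s₃] at hw
  have hgg := (stepPerm h4 h5 c).injective ((stepPerm h4 h5 d).injective hw)
  obtain rfl := eq_of_heq (Sigma.mk.inj hgg).2
  obtain ⟨s, hs, -⟩ := (stage h4 h5 2).flat_of_down hg hg'
  have := P.mul_inv_eq hs
  rw [P.inv_inv'] at this
  simp [this]

theorem mul_ne_none_of_wordProd_five (h4 : P.A4) (h5 : P.A5)
    (hw : P.wordProd [a, b, c, d, e] = 1) (hab : P.mul a b = none) (hde : P.mul d e = none) :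
    P.mul b c ≠ none ∨ P.mul c d ≠ none := by
  obtain ⟨v, g, hv, hg⟩ := exists_down_down (h4 := h4) (h5 := h5) hab
  obtain ⟨v', g', hv', hg'⟩ := exists_down_down (h4 := h4) (h5 := h5) (inv_mul_inv_eq_none hde)
  have hw := congrArg (stepHom h4 h5) hw
  simp only [wordProd, List.map, List.prod_cons, List.prod_nil, map_mul, map_one,
    stepHom_pi, mul_one] at hw
  have hw := congrArg (fun f => f⁻¹ (origin h4 h5)) hw
  simp only [mul_inv_rev, inv_inv, _root_.inv_one, Equiv.Perm.coe_mul, Function.comp,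
    Equiv.Perm.coe_one, id] at hw
  have s₁ : Step h4 h5 (origin h4 h5) a ⟨1, v⟩ := .up hv
  have s₂ : Step h4 h5 ⟨1, v⟩ b ⟨2, g⟩ := .up hg
  have s₃ : Step h4 h5 ⟨2, g'⟩ d ⟨1, v'⟩ := .down hg'
  have s₄ : Step h4 h5 ⟨1, v'⟩ e (origin h4 h5) := .down hv'
  rw [stepPerm_eq s₁, stepPerm_eq s₂, ← stepPerm_eq s₄, ← stepPerm_eq s₃] at hw
  have hgg := (stepPerm h4 h5 d).injective ((stepPerm h4 h5 e).injective hw)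
  have hstep := step_stepPerm h4 h5 ⟨2, g⟩ c
  rw [hgg] at hstep
  have hflat : (stage h4 h5 2).Flat g c g' := by
    cases hstep with
    | flat h => exact h
  rcases hflat with ⟨rfl, -⟩ | ⟨u, y, y', hu, hu', hy⟩
  · exact .inl (by simp [P.mul_one'])
  obtain ⟨s, hs, hvu⟩ := (stage h4 h5 2).flat_of_down hg hu
  obtain ⟨s', hs', huv⟩ := (stage h4 h5 2).flat_of_down hu' hg'
  have hbc : P.LinkAdj (P.inv s) y' → P.mul b c ≠ none := fun h => by
    obtain ⟨m, hm⟩ := h.exists_mul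
    simp [P.mul_assoc_left hs hy hm]
  have hcd : P.LinkAdj s' y → P.mul c d ≠ none := fun h => by
    obtain ⟨m, hm⟩ := Option.isSome_iff_exists.1 h
    have := P.inv_mul_inv_eq (P.mul_assoc_left (P.inv_mul_eq hs') (P.mul_inv_eq hy) hm)
    simp [P.inv_inv'] at this
    simp [this]
  rcases hvu with ⟨rfl, -⟩ | ⟨o, x₁, x, hx₁, hx, hxs⟩
  · exact .inl (hbc (by simp [LinkAdj, P.inv_inv', P.one_mul']))
  rcases huv with ⟨rfl, -⟩ | ⟨o', x', x₂, hx', hx₂, hxs'⟩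
  · exact .inr (hcd (by simp [LinkAdj, P.inv_one, P.one_mul']))
  obtain rfl := Stage.base_next_down_inj hx hx'
  have no : ∀ {y g}, (stage h4 h5 2).down u y g → ¬ P.LinkAdj (P.inv x') y := fun hd e =>
    let ⟨_, hm⟩ := e.exists_mul
    hd.1.false_of_mul hx' hm
  have e₁ : P.LinkAdj (P.inv s) (P.inv x') := linkAdj_inv_inv hxs
  have e₂ : P.LinkAdj (P.inv x') s' := linkAdj_of_mul hxs'
  have e₃ : P.LinkAdj s' y' := linkAdj_right hs'
  have e₄ : P.LinkAdj y' y := linkAdj_left hy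
  have e₅ : P.LinkAdj y (P.inv s) := linkAdj_of_mul' hs
  rcases h5.chord e₁ e₂ e₃ e₄ e₅ with h | h | h | h | h
  · exact (h4.chord h e₃ e₄ e₅).imp hbc hcd
  · exact (no hu' h).elim
  · exact .inr (hcd h)
  · exact .inl (hbc h)
  · exact (no hu h).elim

end ShortWords

end Pree

/-- In a pree satisfying A(4) and A(5), every word of length 4 or 5 whose
image in the universal group is the identity is reducible. -/
theorem pree_short_trivial_words_reducible {α : Type*} (P : Pree α)
    (h4 : P.A4) (h5 : P.A5) (w : List α)
    (hlen : w.length = 4 ∨ w.length = 5) (hw : P.wordProd w = 1) :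
    P.Reducible w := by
  rcases hlen with hlen | hlen
  · obtain ⟨a, b, c, d, rfl⟩ := List.length_eq_four.1 hlen
    by_cases hab : P.mul a b = none
    · by_cases hcd : P.mul c d = none
      · have := Pree.mul_ne_none_of_wordProd_four h4 h5 hw hab hcd
        exact ⟨[a], b, c, [d], rfl, Option.isSome_iff_ne_none.2 this⟩
      · exact ⟨[a, b], c, d, [], rfl, Option.isSome_iff_ne_none.2 hcd⟩
    · exact ⟨[], a, b, [c, d], rfl, Option.isSome_iff_ne_none.2 hab⟩
  · match w, hlen with
    | [a, b, c, d, e], _ =>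
      by_cases hab : P.mul a b = none
      · by_cases hde : P.mul d e = none
        · rcases Pree.mul_ne_none_of_wordProd_five h4 h5 hw hab hde with h | h
          · exact ⟨[a], b, c, [d, e], rfl, Option.isSome_iff_ne_none.2 h⟩
          · exact ⟨[a, b], c, d, [e], rfl, Option.isSome_iff_ne_none.2 h⟩
        · exact ⟨[a, b, c], d, e, [], rfl, Option.isSome_iff_ne_none.2 hde⟩
      · exact ⟨[], a, b, [c, d, e], rfl, Option.isSome_iff_ne_none.2 hab⟩
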